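/- arXiv:2307.04022 — 2 statements merged into one kernel-verified Lean document; each statement's English description precedes it below -/
import Mathlib

section
/- Let ε ∈ (0,1), let d ∈ ℕ, and let a, b ∈ ℝ^d (Euclidean space with the standard inner product). With g(t) := (1−ε)/√(t² + ε²) and f_ε(t) := (1−ε)·√(t² + ε²), the inequality g(‖a‖)·⟪b, b − a⟫ ≥ f_ε(‖b‖) − f_ε(‖a‖) + (1/2)·g(‖a‖)·‖b − a‖² holds. -/
open RealInnerProductSpace

/-- Lemma 5.3: the key inequality for the unconditional strong stability of the
semi-implicit discretized L²-gradient flow. -/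
theorem gradient_flow_key_inequality (ε : ℝ) (hε : ε ∈ Set.Ioo (0 : ℝ) 1)
    (d : ℕ) (a b : EuclideanSpace ℝ (Fin d)) :
    (1 - ε) / Real.sqrt (‖a‖ ^ 2 + ε ^ 2) * ⟪b, b - a⟫
      ≥ (1 - ε) * Real.sqrt (‖b‖ ^ 2 + ε ^ 2) - (1 - ε) * Real.sqrt (‖a‖ ^ 2 + ε ^ 2)
        + (1 / 2) * ((1 - ε) / Real.sqrt (‖a‖ ^ 2 + ε ^ 2)) * ‖b - a‖ ^ 2 := by
  have hS : 0 < Real.sqrt (‖a‖ ^ 2 + ε ^ 2) :=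
    Real.sqrt_pos.2 (add_pos_of_nonneg_of_pos (sq_nonneg _) (pow_pos hε.1 2))
  have hS2 : Real.sqrt (‖a‖ ^ 2 + ε ^ 2) ^ 2 = ‖a‖ ^ 2 + ε ^ 2 := Real.sq_sqrt (by positivity)
  have hT2 : Real.sqrt (‖b‖ ^ 2 + ε ^ 2) ^ 2 = ‖b‖ ^ 2 + ε ^ 2 := Real.sq_sqrt (by positivity)
  set S := Real.sqrt (‖a‖ ^ 2 + ε ^ 2)
  set T := Real.sqrt (‖b‖ ^ 2 + ε ^ 2)
  have hinner : ⟪b, b - a⟫ = (T ^ 2 - S ^ 2 + ‖b - a‖ ^ 2) / 2 := by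
    rw [hS2, hT2, norm_sub_sq_real, inner_sub_right, real_inner_self_eq_norm_sq]
    ring
  have hgap : 0 ≤ (1 - ε) / (2 * S) * (T - S) ^ 2 :=
    mul_nonneg (div_nonneg (sub_nonneg.2 hε.2.le) (by positivity)) (sq_nonneg _)
  have hdiff : (1 - ε) / S * ⟪b, b - a⟫
      - ((1 - ε) * T - (1 - ε) * S + (1 / 2) * ((1 - ε) / S) * ‖b - a‖ ^ 2)
      = (1 - ε) / (2 * S) * (T - S) ^ 2 := by
    rw [hinner]
    field_simp
    ring
  linarith
end

section
/- Let Y be a real vector space, E a real inner product space, T : Y → E a linear map, G : Y → ℝ a convex function, α > 0 and w ∈ E, and set N(y) := G(y) + (1/(2α))·‖T y + w‖². If z ∈ Y is a minimizer of N (i.e., N(z) ≤ N(y) for all y ∈ Y), then for every y ∈ Y one has N(y) − N(z) ≥ (1/(2α))·‖T y − T z‖². -/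
/-- The squared norm of a convex combination in a real inner product space. -/
theorem norm_sq_convex_combination {E : Type*} [NormedAddCommGroup E] [InnerProductSpace ℝ E]
    (a b : E) (t : ℝ) :
    ‖(1 - t) • a + t • b‖ ^ 2
      = (1 - t) * ‖a‖ ^ 2 + t * ‖b‖ ^ 2 - t * (1 - t) * ‖b - a‖ ^ 2 := by
  rw [norm_add_sq_real, norm_sub_sq_real, norm_smul, norm_smul, mul_pow, mul_pow,
    Real.norm_eq_abs, Real.norm_eq_abs, sq_abs, sq_abs, real_inner_smul_left,
    real_inner_smul_right, real_inner_comm a b]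
  ring

/-- A bound by all proper fractions of `D` is a bound by `D`. -/
theorem le_of_forall_one_sub_mul_le {D δ : ℝ} (hδ : 0 ≤ δ)
    (h : ∀ t : ℝ, 0 < t → t < 1 → (1 - t) * D ≤ δ) : D ≤ δ := by
  by_contra! hlt
  have hD : 0 < D := hδ.trans_lt hlt
  have key := h ((D - δ) / (2 * D)) (div_pos (by linarith) (by linarith))
    ((div_lt_one (by linarith)).2 (by linarith))
  have heq : (1 - (D - δ) / (2 * D)) * D = (D + δ) / 2 := by
    field_simp
    ring
  linarith

/-- Remark 3.3 (iv), dual part: strong-convexity lower bound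
`N(y) − N(z) ≥ (1/(2α))‖T y − T z‖²` at a minimizer `z` of
`N(y) = G(y) + (1/(2α))‖T y + w‖²`. -/
theorem dual_strong_convexity_bound
    {Y : Type*} [AddCommGroup Y] [Module ℝ Y]
    {E : Type*} [NormedAddCommGroup E] [InnerProductSpace ℝ E]
    (T : Y →ₗ[ℝ] E) (G : Y → ℝ) (hG : ConvexOn ℝ Set.univ G)
    (α : ℝ) (hα : 0 < α) (w : E) (z : Y)
    (hz : ∀ y : Y, G z + (1 / (2 * α)) * ‖T z + w‖ ^ 2
                    ≤ G y + (1 / (2 * α)) * ‖T y + w‖ ^ 2) :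
    ∀ y : Y,
      (G y + (1 / (2 * α)) * ‖T y + w‖ ^ 2) - (G z + (1 / (2 * α)) * ‖T z + w‖ ^ 2)
        ≥ (1 / (2 * α)) * ‖T y - T z‖ ^ 2 := by
  intro y
  refine le_of_forall_one_sub_mul_le (sub_nonneg.2 (hz y)) fun t ht0 ht1 => ?_
  have hmin := hz ((1 - t) • z + t • y)
  have hconv : G ((1 - t) • z + t • y) ≤ (1 - t) * G z + t * G y :=
    hG.2 (Set.mem_univ z) (Set.mem_univ y) (by linarith) ht0.le (by ring)
  have hT : T ((1 - t) • z + t • y) + w = (1 - t) • (T z + w) + t • (T y + w) := by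
    rw [map_add, map_smul, map_smul]
    module
  rw [hT, norm_sq_convex_combination, add_sub_add_right_eq_sub] at hmin
  refine le_of_mul_le_mul_left ?_ ht0
  linarith
end
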